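/- For any integer r ≥ 2 and any partition λ, the plethysm p_r ∘ S_λ equals the sum over all partitions μ of r|λ| with empty r-core of δ_r(μ)·LR^λ_{μ[0],…,μ[r−1]}·S_μ, where (μ[0],…,μ[r−1]) is the r-quotient of μ. -/

import Mathlib

open scoped BigOperators

/-- A partition, represented canonically as the multiset of its (positive) parts. -/
structure Ptn where
  parts : Multiset ℕ
  pos : ∀ x ∈ parts, 0 < x

namespace Ptn

/-- Build a partition from an arbitrary multiset of naturals by discarding zero parts. -/
def of (s : Multiset ℕ) : Ptn :=
  ⟨s.filter (fun x => 0 < x), fun _ hx => (Multiset.mem_filter.mp hx).2⟩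

/-- The empty partition. -/
def empty : Ptn := ⟨0, by simp⟩

/-- The `i`-th largest part (`0`-indexed); `0` if `i` is at least the number of parts. -/
def part (l : Ptn) (i : ℕ) : ℕ :=
  ((l.parts.sort (· ≤ ·)).reverse).getD i 0

/-- The number of (positive) parts. -/
def length (l : Ptn) : ℕ := Multiset.card l.parts

/-- The size `|λ|`, i.e. the number being partitioned. -/
def size (l : Ptn) : ℕ := l.parts.sum

/-- A partition is strict if all its parts are distinct. -/
def Strict (l : Ptn) : Prop := l.parts.Nodup

/-- The conjugate partition. -/
def conj (l : Ptn) : Ptn :=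
  of ((Multiset.range (l.part 0)).map
    (fun j => Multiset.card (l.parts.filter (fun x => j < x))))

end Ptn

/-- The rectangular partition `□(n,m)` with `n` rows of length `m`. -/
def rect (n m : ℕ) : Ptn := Ptn.of (Multiset.replicate n m)

/-- The partition obtained by multiplying every part by `r`. -/
def scaleP (r : ℕ) (l : Ptn) : Ptn := Ptn.of (l.parts.map (fun a => r * a))

/-- Diagram containment: every part of `small` is at most the corresponding part of `big`. -/
def Contains (big small : Ptn) : Prop := ∀ i, small.part i ≤ big.part i

/-- The beta-set (first-column hook lengths) `{λ_i + m - 1 - i : i < m}` of `l`,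
computed with `m` beads (`m` at least the number of parts). -/
def betaSet (l : Ptn) (m : ℕ) : Finset ℕ :=
  (Finset.range m).image (fun i => l.part i + (m - 1 - i))

/-- The partition encoded by a finite set of bead positions: each bead contributes a part
equal to the number of empty positions (holes) below it. -/
def ptnOfBeads (B : Finset ℕ) : Ptn :=
  Ptn.of (B.val.map (fun p => p - (B.filter (fun q => q < p)).card))

/-- Levels of the beads on runner `k` of the `r`-abacus of `l`,
drawn with `r * l.length` beads (a multiple of `r`). -/
def runnerLevels (r : ℕ) (l : Ptn) (k : ℕ) : Finset ℕ :=
  (Finset.range (l.part 0 + r * l.length + 1)).filter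
    (fun s => r * s + k ∈ betaSet l (r * l.length))

/-- The `k`-th component `λ[k]` of the `r`-quotient of `l`. -/
def quotP (r : ℕ) (l : Ptn) (k : ℕ) : Ptn := ptnOfBeads (runnerLevels r l k)

/-- The `r`-core of `l`: push all beads of the `r`-abacus down as far as possible. -/
def coreP (r : ℕ) (l : Ptn) : Ptn :=
  ptnOfBeads ((Finset.range r).biUnion
    (fun k => (Finset.range (runnerLevels r l k).card).image (fun s => r * s + k)))

/-- The key of the bead at position `p` for the `r`-numbering of the beads `B`:
a bead which is the `j`-th lowest bead on runner `k` gets key `r * j + k`. -/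
def rKey (r : ℕ) (B : Finset ℕ) (p : ℕ) : ℕ :=
  r * (B.filter (fun q => q % r = p % r ∧ q < p)).card + p % r

/-- The number of inversions between the natural (increasing-position) numbering of the
beads `B` and the numbering by increasing `key`. -/
def inversions (key : ℕ → ℕ) (B : Finset ℕ) : ℕ :=
  ((B ×ˢ B).filter (fun pq => pq.1 < pq.2 ∧ key pq.2 < key pq.1)).card

/-- Exponent of the `r`-sign `δ_r`. -/
def rSignExp (r : ℕ) (l : Ptn) : ℕ :=
  inversions (rKey r (betaSet l (r * l.length))) (betaSet l (r * l.length))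

/-- The `r`-sign `δ_r(λ) ∈ {±1}`. -/
def rSign (r : ℕ) (l : Ptn) : ℤ := (-1) ^ rSignExp r l

/-- The key of the bead at position `p` for the `3`-bar numbering of the beads `B` of the
`3`-bar abacus: first the beads of runner `0` in increasing order, then the pairs of beads
on runners `2` and `1` paired off by increasing level (runner-`2` bead before
runner-`1` bead), then the remaining unpaired beads in increasing order. -/
def barKey (B : Finset ℕ) (p : ℕ) : ℕ :=
  let n0 := (B.filter (fun q => q % 3 = 0)).card
  let t := min ((B.filter (fun q => q % 3 = 1)).card)
              ((B.filter (fun q => q % 3 = 2)).card)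
  let rk := (B.filter (fun q => q % 3 = p % 3 ∧ q < p)).card
  if p % 3 = 0 then rk
  else if rk < t then (if p % 3 = 2 then n0 + 2 * rk else n0 + 2 * rk + 1)
  else n0 + 2 * t + (rk - t)

/-- Exponent of the `3`-bar sign `δ̄_3`.  The beads of the `3`-bar abacus of a strict
partition sit at the positions given by the parts. -/
def barSignExp (l : Ptn) : ℕ :=
  inversions (barKey l.parts.toFinset) l.parts.toFinset

/-- The `3`-bar sign `δ̄_3(λ) ∈ {±1}` of a strict partition. -/
def barSign3 (l : Ptn) : ℤ := (-1) ^ barSignExp l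

/-- The double `D(λ) = (λ_1,…,λ_l | λ_1 - 1,…,λ_l - 1)` (Frobenius notation)
of a strict partition `λ`, constructed row by row. -/
noncomputable def double (l : Ptn) : Ptn :=
  Ptn.of ((Multiset.range (l.length + l.part 0)).map (fun i =>
    (if i < l.length then l.part i + 1 else 0) +
      ((Finset.range (min i l.length)).filter (fun j => i + 1 ≤ j + l.part j)).card))

/-- The second component `λ^b[1] = D(λ)[1]` of the `3`-bar quotient of a strict
partition `λ`. -/
noncomputable def barQuot1 (l : Ptn) : Ptn := quotP 3 (double l) 1

/-- The staircase-like strict partition `Λ_ℓ = (3ℓ-2, 3ℓ-5, …, 7, 4, 1)`. -/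
def LamP (ℓ : ℕ) : Ptn := Ptn.of ((Multiset.range ℓ).map (fun i => 3 * i + 1))

/-- The staircase partition `Δ_ℓ = (ℓ, ℓ-1, …, 1)`. -/
def DelP (ℓ : ℕ) : Ptn := Ptn.of (Multiset.range (ℓ + 1))

/-- `F_1^m(Λ_ℓ)`: strict partitions obtained from `Λ_ℓ` by adding `m` cells, each
labelled `1`, where the cell in (0-indexed) column `j` is labelled `1` iff `j % 3 = 1`
(each row reads `0,1,0,0,1,0,…`). -/
def F1Lam (ℓ m : ℕ) : Set Ptn :=
  {mu | mu.Strict ∧ Contains mu (LamP ℓ) ∧ mu.size = (LamP ℓ).size + m ∧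
    ∀ i j, (LamP ℓ).part i ≤ j → j < mu.part i → j % 3 = 1}

/-- `F_1^m(Δ_ℓ)`: partitions obtained from `Δ_ℓ` by adding `m` cells, each labelled `1`,
where the cell `(i,j)` is labelled `1` iff `i + j` is odd. -/
def F1Del (ℓ m : ℕ) : Set Ptn :=
  {mu | Contains mu (DelP ℓ) ∧ mu.size = (DelP ℓ).size + m ∧
    ∀ i j, (DelP ℓ).part i ≤ j → j < mu.part i → (i + j) % 2 = 1}

/-- `(α, β)` is complementary relative to the rectangle `□(n,m)`:
`α ⊆ □(n,m)` and `β_i = m - α_{n+1-i}` for `1 ≤ i ≤ n` (0-indexed below). -/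
def Complementary (n m : ℕ) (a b : Ptn) : Prop :=
  a.length ≤ n ∧ a.part 0 ≤ m ∧ b.length ≤ n ∧
    ∀ i < n, b.part i = m - a.part (n - 1 - i)

/-- `W(n,m)`: the set of `(n,m)`-balanced partitions, i.e. partitions of `2nm` with at
most `2n` parts satisfying `μ_i + μ_{2n+1-i} = 2m` for `1 ≤ i ≤ n` (0-indexed below). -/
def W (n m : ℕ) : Set Ptn :=
  {mu | mu.size = 2 * n * m ∧ mu.length ≤ 2 * n ∧
    ∀ i < n, mu.part i + mu.part (2 * n - 1 - i) = 2 * m}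

/-! ### The ring of symmetric functions

We realise the ring of symmetric functions (with rational coefficients) as the
polynomial ring `ℚ[p_1, p_2, …]` in the power sums: the variable `X n` of
`MvPolynomial ℕ ℚ` stands for the power sum `p_{n+1}`. -/

abbrev SymF := MvPolynomial ℕ ℚ

open MvPolynomial

/-- `z_ρ = ∏ a^{m_a} m_a!` for a partition given as a multiset `ρ`. -/
def zval (s : Multiset ℕ) : ℚ :=
  s.toFinset.prod (fun a => (a : ℚ) ^ s.count a * (Nat.factorial (s.count a) : ℚ))

/-- The power sum product `p_ρ` of a multiset `ρ`. -/
noncomputable def pMult (s : Multiset ℕ) : SymF :=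
  (s.map (fun a => (X (a - 1) : SymF))).prod

/-- The complete homogeneous symmetric function `h_n = Σ_{ρ ⊢ n} z_ρ⁻¹ p_ρ`. -/
noncomputable def hSym (n : ℕ) : SymF :=
  ∑ ρ : Nat.Partition n, (zval ρ.parts)⁻¹ • pMult ρ.parts

/-- `h_k` for an integer index, vanishing for negative `k`. -/
noncomputable def hz (k : ℤ) : SymF := if k < 0 then 0 else hSym k.toNat

/-- The Schur function `S_λ`, via the Jacobi–Trudi formula
`S_λ = det(h_{λ_i - i + j})`. -/
noncomputable def schur (l : Ptn) : SymF :=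
  Matrix.det (Matrix.of (fun i j : Fin l.length =>
    hz ((l.part i.val : ℤ) + (j.val : ℤ) - (i.val : ℤ))))

/-- The plethysm `p_r ∘ f`: the algebra endomorphism sending each power sum `p_k`
to `p_{rk}`, i.e. substituting `x_i^r` for each variable `x_i`. -/
noncomputable def pleth (r : ℕ) (f : SymF) : SymF :=
  MvPolynomial.aeval (fun n => (X (r * (n + 1) - 1) : SymF)) f

/-- The `z`-weight of a power-sum monomial (exponent vector `d`). -/
def zfac (d : ℕ →₀ ℕ) : ℚ :=
  d.prod (fun i e => ((i : ℚ) + 1) ^ e * (Nat.factorial e : ℚ))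

/-- The Hall inner product, for which `⟨p_ρ, p_σ⟩ = δ_{ρσ} z_ρ` and the Schur
functions are orthonormal. -/
noncomputable def hall (f g : SymF) : ℚ :=
  f.support.sum (fun d => f.coeff d * g.coeff d * zfac d)

/-- The multi-Littlewood–Richardson coefficient `LR^λ_{μ^0,…,μ^{r-1}}`:
the multiplicity of `S_λ` in `S_{μ^0} ⋯ S_{μ^{r-1}}`. -/
noncomputable def LRmulti (lam : Ptn) (r : ℕ) (q : ℕ → Ptn) : ℚ :=
  hall ((Finset.range r).prod (fun k => schur (q k))) (schur lam)

/-- The Littlewood–Richardson coefficient `LR^λ_{α,β}`: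
the multiplicity of `S_λ` in `S_α · S_β`. -/
noncomputable def LR2 (lam a b : Ptn) : ℚ := hall (schur a * schur b) (schur lam)

/-- The irreducible symmetric group character `χ^μ(ρ)`, via the Frobenius formula
`χ^μ_ρ = ⟨S_μ, p_ρ⟩`. -/
noncomputable def chi (mu rho : Ptn) : ℚ := hall (schur mu) (pMult rho.parts)

/-- Symmetric functions in two alphabets `u`, `v`: `X (inl n)` is `p_{n+1}(u)` and
`X (inr n)` is `p_{n+1}(v)`. -/
abbrev SymF2 := MvPolynomial (ℕ ⊕ ℕ) ℚ

/-- `f ↦ f(u)`. -/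
noncomputable def toU : SymF →ₐ[ℚ] SymF2 :=
  aeval (fun n => (X (Sum.inl n) : SymF2))

/-- `f ↦ f(v)`. -/
noncomputable def toV : SymF →ₐ[ℚ] SymF2 :=
  aeval (fun n => (X (Sum.inr n) : SymF2))

/-- `f ↦ f(u - v)`, the difference of alphabets: `p_k ↦ p_k(u) - p_k(v)`. -/
noncomputable def toUV : SymF →ₐ[ℚ] SymF2 :=
  aeval (fun n => (X (Sum.inl n) : SymF2) - X (Sum.inr n))

/-- The degree weight: the variable `X i` stands for `p_{i+1}`. -/
def symWt (i : ℕ) : ℕ := i + 1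

theorem zfac_pos (d : ℕ →₀ ℕ) : 0 < zfac d :=
  Finset.prod_pos fun i _ => by positivity

theorem zfac_add_single (d : ℕ →₀ ℕ) (i : ℕ) :
    zfac (d + Finsupp.single i 1) = ((i : ℚ) + 1) * ((d i : ℚ) + 1) * zfac d := by
  classical
  set T := insert i d.support with hT
  have h1 : d.support ⊆ T := Finset.subset_insert _ _
  have h2 : (d + Finsupp.single i 1).support ⊆ T := by
    intro j hj
    by_cases hji : j = i
    · simp [hT, hji]
    · simp [hT, hji] at hj ⊢
      exact hj
  have hi : i ∈ T := Finset.mem_insert_self _ _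
  unfold zfac
  rw [Finsupp.prod_of_support_subset _ h1 _ (by simp),
    Finsupp.prod_of_support_subset _ h2 _ (by simp),
    ← Finset.mul_prod_erase T _ hi, ← Finset.mul_prod_erase T _ hi]
  have : ∀ j ∈ T.erase i, (d + Finsupp.single i 1 : ℕ →₀ ℕ) j = d j := by
    intro j hj
    simp [Finset.ne_of_mem_erase hj]
  rw [Finset.prod_congr rfl fun j hj => by rw [this j hj]]
  simp only [Finsupp.add_apply, Finsupp.single_eq_same, Nat.factorial_succ, pow_succ]
  push_cast
  ring

theorem coeff_pMult (s : Multiset ℕ) (d : ℕ →₀ ℕ) :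
    coeff d (pMult s) = if Multiset.toFinsupp (s.map fun a => a - 1) = d then 1 else 0 := by
  have : pMult s = monomial (Multiset.toFinsupp (s.map fun a => a - 1)) 1 := by
    unfold pMult
    induction s using Multiset.induction_on with
    | empty => simp
    | cons a s ih =>
      rw [Multiset.map_cons, Multiset.prod_cons, ih, Multiset.map_cons, ← Multiset.singleton_add,
        map_add, Multiset.toFinsupp_singleton, X, monomial_mul, one_mul]
  rw [this, coeff_monomial]

theorem map_add_map_sub {s : Multiset ℕ} (h : ∀ x ∈ s, 0 < x) :
    (s.map fun a => a - 1).map (fun a => a + 1) = s := by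
  rw [Multiset.map_map]
  conv_rhs => rw [← Multiset.map_id s]
  exact Multiset.map_congr rfl fun x hx => Nat.succ_pred_eq_of_pos (h x hx)

theorem zval_map_succ (d : ℕ →₀ ℕ) :
    zval ((Finsupp.toMultiset d).map fun a => a + 1) = zfac d := by
  classical
  have hinj : Function.Injective (fun a : ℕ => a + 1) := add_left_injective 1
  unfold zval zfac
  rw [Multiset.toFinset_map, Finset.prod_image hinj.injOn, Finsupp.toFinset_toMultiset]
  refine Finset.prod_congr rfl fun i _ => ?_
  rw [Multiset.count_map_eq_count' _ _ hinj, Finsupp.count_toMultiset]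
  push_cast
  rfl

theorem sum_map_succ (d : ℕ →₀ ℕ) :
    ((Finsupp.toMultiset d).map fun a => a + 1).sum = Finsupp.weight symWt d := by
  induction d using Finsupp.induction_linear with
  | zero => simp
  | add f g hf hg => rw [map_add, map_add, Multiset.map_add, Multiset.sum_add, hf, hg]
  | single i n =>
    simp [Finsupp.toMultiset_single, Finsupp.weight_apply, symWt, Multiset.sum_nsmul, mul_add]

theorem coeff_hSym (n : ℕ) (d : ℕ →₀ ℕ) :
    coeff d (hSym n) = if Finsupp.weight symWt d = n then (zfac d)⁻¹ else 0 := by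
  classical
  unfold hSym
  simp only [coeff_sum, coeff_smul, coeff_pMult, smul_eq_mul, mul_ite, mul_one, mul_zero]
  split_ifs with h
  · let ρ : Nat.Partition n := ⟨(Finsupp.toMultiset d).map fun a => a + 1,
      fun hi => by simp at hi; omega, by rw [sum_map_succ, h]⟩
    rw [Finset.sum_eq_single ρ, if_pos, zval_map_succ]
    · simp [ρ]
    · intro b _ hb
      rw [if_neg]
      rintro rfl
      apply hb
      ext1
      simp only [ρ, Multiset.toFinsupp_toMultiset]
      exact (map_add_map_sub fun x hx => b.parts_pos hx).symm
    · simp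
  · refine Finset.sum_eq_zero fun b _ => if_neg ?_
    rintro rfl
    apply h
    rw [← sum_map_succ, Multiset.toFinsupp_toMultiset, map_add_map_sub fun x hx => b.parts_pos hx,
      b.parts_sum]

theorem hall_eq_sum {f : SymF} (g : SymF) {T : Finset (ℕ →₀ ℕ)} (h : f.support ⊆ T) :
    hall f g = ∑ d ∈ T, coeff d f * coeff d g * zfac d :=
  Finset.sum_subset h fun d _ hd => by rw [notMem_support_iff.mp hd, zero_mul, zero_mul]

theorem hall_comm (f g : SymF) : hall f g = hall g f := by
  classical
  rw [hall_eq_sum g (Finset.subset_union_left (s₂ := g.support)),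
    hall_eq_sum f (Finset.subset_union_right (s₁ := f.support))]
  exact Finset.sum_congr rfl fun d _ => by ring

theorem hall_add_right (f g g' : SymF) : hall f (g + g') = hall f g + hall f g' := by
  simp only [hall, coeff_add, ← Finset.sum_add_distrib]
  exact Finset.sum_congr rfl fun d _ => by ring

theorem hall_smul_right (a : ℚ) (f g : SymF) : hall f (a • g) = a • hall f g := by
  simp only [hall, coeff_smul, smul_eq_mul, Finset.mul_sum]
  exact Finset.sum_congr rfl fun d _ => by ring

/-- The Hall inner product as a bilinear form. -/
noncomputable def hallForm : SymF →ₗ[ℚ] SymF →ₗ[ℚ] ℚ :=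
  LinearMap.mk₂ ℚ hall
    (fun f f' g => by rw [hall_comm, hall_add_right, hall_comm g, hall_comm g])
    (fun a f g => by rw [hall_comm, hall_smul_right, hall_comm g])
    hall_add_right (fun a f g => hall_smul_right a f g)

theorem hallForm_apply (f g : SymF) : hallForm f g = hall f g := rfl

theorem hall_monomial (f : SymF) (d : ℕ →₀ ℕ) (a : ℚ) :
    hall f (monomial d a) = coeff d f * a * zfac d := by
  classical
  rw [hall_comm, hall_eq_sum f (support_monomial_subset (s := d) (a := a)), Finset.sum_singleton,
    coeff_monomial, if_pos rfl]
  ring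

/-- Multiplication by `p_{i+1}` is adjoint to `(i + 1) ∂/∂p_{i+1}`. -/
theorem hall_X_mul (f g : SymF) (i : ℕ) :
    hall f (X i * g) = ((i : ℚ) + 1) * hall (pderiv i f) g := by
  induction g using MvPolynomial.induction_on' with
  | monomial d a =>
    rw [X, monomial_mul, one_mul, hall_monomial, hall_monomial, coeff_pderiv, add_comm,
      zfac_add_single]
    ring
  | add p q hp hq => rw [mul_add, hall_add_right, hall_add_right, hp, hq, mul_add]

theorem pderiv_hSym (i n : ℕ) :
    ((i : ℚ) + 1) • pderiv i (hSym n) = if i + 1 ≤ n then hSym (n - (i + 1)) else 0 := by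
  ext d
  rw [coeff_smul, coeff_pderiv, coeff_hSym, map_add, Finsupp.weight_single, zfac_add_single]
  have hz := (zfac_pos d).ne'
  simp only [symWt, smul_eq_mul, one_mul]
  split_ifs with h1 h2 h2
  · rw [coeff_hSym, if_pos (by omega)]
    field_simp
  · omega
  · rw [coeff_hSym, if_neg (by omega)]
    simp
  · simp

theorem weight_eq_sum_range {d : ℕ →₀ ℕ} {n : ℕ} (h : Finsupp.weight symWt d ≤ n) :
    ∑ k ∈ Finset.range n, d k * (k + 1) = Finsupp.weight symWt d := by
  rw [Finsupp.weight_apply, Finsupp.sum]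
  refine (Finset.sum_subset (fun k hk => ?_) fun k _ hk => ?_).symm
  · have := Finsupp.le_weight_of_ne_zero' symWt (Finsupp.mem_support_iff.mp hk)
    rw [symWt] at this
    exact Finset.mem_range.mpr (by omega)
  · simp [Finsupp.notMem_support_iff.mp hk]

/-- The Newton identity between complete functions and power sums. -/
theorem newton_hSym (n : ℕ) :
    (n : ℚ) • hSym n = ∑ k ∈ Finset.range n, X k * hSym (n - 1 - k) := by
  classical
  ext d
  rw [coeff_smul, coeff_sum, coeff_hSym]
  have key : ∀ k ∈ Finset.range n, coeff d (X k * hSym (n - 1 - k)) =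
      if Finsupp.weight symWt d = n then ((d k * (k + 1) : ℕ) : ℚ) * (zfac d)⁻¹ else 0 := by
    intro k hk
    rw [coeff_X_mul']
    split_ifs with h1 h2 h2
    · obtain ⟨e, rfl⟩ : ∃ e, d = e + Finsupp.single k 1 :=
        ⟨d - Finsupp.single k 1, (tsub_add_cancel_of_le (by
          simpa [Nat.one_le_iff_ne_zero] using h1)).symm⟩
      rw [map_add, Finsupp.weight_single, symWt] at h2
      rw [add_tsub_cancel_right, coeff_hSym, if_pos (by simp at h2; omega), zfac_add_single]
      have hz := (zfac_pos e).ne'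
      simp
      field_simp
    · obtain ⟨e, rfl⟩ : ∃ e, d = e + Finsupp.single k 1 :=
        ⟨d - Finsupp.single k 1, (tsub_add_cancel_of_le (by
          simpa [Nat.one_le_iff_ne_zero] using h1)).symm⟩
      rw [map_add, Finsupp.weight_single, symWt] at h2
      rw [add_tsub_cancel_right, coeff_hSym, if_neg]
      have := Finset.mem_range.mp hk
      simp at h2; omega
    · simp [Finsupp.notMem_support_iff.mp h1]
    · rfl
  rw [Finset.sum_congr rfl key]
  split_ifs with h
  · rw [← Finset.sum_mul, ← Nat.cast_sum, weight_eq_sum_range h.le, h, smul_eq_mul]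
  · simp

theorem hSym_zero : hSym 0 = 1 := by
  ext d
  rw [coeff_hSym, coeff_one]
  by_cases h : d = 0
  · subst h
    simp [zfac]
  · rw [if_neg (Ne.symm h), if_neg]
    intro h0
    obtain ⟨i, hi⟩ := Finsupp.ne_iff.mp h
    have := Finsupp.le_weight_of_ne_zero' symWt hi
    rw [symWt] at this
    omega

/-- A sequence satisfying the image of the Newton identity under an algebra hom is the image of
`hSym`. -/
theorem map_hSym_of_newton {R : Type*} [CommRing R] [Algebra ℚ R] (φ : SymF →ₐ[ℚ] R) (c : ℕ → R)
    (h0 : c 0 = 1)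
    (hc : ∀ n : ℕ, (n : ℚ) • c n = ∑ k ∈ Finset.range n, φ (X k) * c (n - 1 - k)) (n : ℕ) :
    φ (hSym n) = c n := by
  induction n using Nat.strong_induction_on with
  | _ n ih =>
    rcases Nat.eq_zero_or_pos n with rfl | hn
    · rw [hSym_zero, map_one, h0]
    · have h1 : (n : ℚ) • φ (hSym n) = (n : ℚ) • c n := by
        rw [← map_smul, newton_hSym, hc, map_sum]
        refine Finset.sum_congr rfl fun k hk => ?_
        rw [map_mul, ih _ (by omega)]
      have hn' : (n : ℚ) ≠ 0 := by positivity
      have := congrArg ((n : ℚ)⁻¹ • ·) h1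
      simpa [smul_smul, inv_mul_cancel₀ hn'] using this

/-- The adjoint of the plethysm by `p_r`: it sends `p_{rk}` to `r p_k` and `p_m` to `0` when
`r ∤ m`. -/
noncomputable def plethAdj (r : ℕ) : SymF →ₐ[ℚ] SymF :=
  aeval fun n => if r ∣ n + 1 then (r : SymF) * X ((n + 1) / r - 1) else 0

theorem plethAdj_X (r n : ℕ) :
    plethAdj r (X n) = if r ∣ n + 1 then (r : SymF) * X ((n + 1) / r - 1) else 0 := by
  rw [plethAdj, aeval_X]

theorem plethAdj_hSym {r : ℕ} (hr : 0 < r) (n : ℕ) :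
    plethAdj r (hSym n) = if r ∣ n then hSym (n / r) else 0 := by
  refine map_hSym_of_newton (plethAdj r) (fun n => if r ∣ n then hSym (n / r) else 0)
    (by simp [hSym_zero]) (fun n => ?_) n
  simp only [plethAdj_X]
  split_ifs with h
  · obtain ⟨m, rfl⟩ := h
    rw [Nat.mul_div_cancel_left _ hr, Nat.cast_mul, mul_smul, newton_hSym, Finset.smul_sum]
    symm
    have hinj : Set.InjOn (fun k => r * (k + 1) - 1) (Finset.range m : Set ℕ) := by
      intro a _ b _ hab
      have ha : 0 < r * (a + 1) := by positivity
      have hb : 0 < r * (b + 1) := by positivity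
      have : r * (a + 1) = r * (b + 1) := by simp only at hab; omega
      have := Nat.eq_of_mul_eq_mul_left hr this
      omega
    rw [← Finset.sum_subset (s₁ := (Finset.range m).image fun k => r * (k + 1) - 1),
      Finset.sum_image hinj]
    · refine Finset.sum_congr rfl fun k hk => ?_
      have ha : 0 < r * (k + 1) := by positivity
      have hk' := Finset.mem_range.mp hk
      have hle : r * (k + 1) ≤ r * m := Nat.mul_le_mul_left _ hk'
      have e1 : r * (k + 1) - 1 + 1 = r * (k + 1) := by omega
      have e2 : r * m - 1 - (r * (k + 1) - 1) = r * (m - 1 - k) := by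
        rw [show m - 1 - k = m - (k + 1) by omega, Nat.mul_sub]; omega
      rw [e1, e2, if_pos (dvd_mul_right _ _), if_pos (dvd_mul_right _ _),
        Nat.mul_div_cancel_left _ hr, Nat.mul_div_cancel_left _ hr, Nat.add_sub_cancel, mul_assoc,
        Nat.cast_smul_eq_nsmul, nsmul_eq_mul]
    · intro j hj
      obtain ⟨k, hk, rfl⟩ := Finset.mem_image.mp hj
      have hle : r * (k + 1) ≤ r * m := Nat.mul_le_mul_left _ (Finset.mem_range.mp hk)
      have ha : 0 < r * (k + 1) := by positivity
      exact Finset.mem_range.mpr (by omega)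
    · intro j hj hj'
      rw [if_neg, zero_mul]
      rintro ⟨c, hc⟩
      apply hj'
      rcases c with _ | c
      · simp at hc
      · refine Finset.mem_image.mpr ⟨c, Finset.mem_range.mpr ?_, by omega⟩
        have := Finset.mem_range.mp hj
        exact Nat.lt_of_mul_lt_mul_left (a := r) (by rw [mul_add] at hc; omega)
  · rw [smul_zero]
    refine (Finset.sum_eq_zero fun k hk => ?_).symm
    have hk' := Finset.mem_range.mp hk
    by_cases h1 : r ∣ k + 1
    · rw [if_neg (c := r ∣ n - 1 - k), mul_zero]
      intro h2
      exact h (by simpa [show k + 1 + (n - 1 - k) = n by omega] using dvd_add h1 h2)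
    · rw [if_neg h1, zero_mul]

/-- Substitution of `r (i + 1) - 1` for the index `i` of a power sum. -/
def scaleIdx (r i : ℕ) : ℕ := r * (i + 1) - 1

theorem scaleIdx_add_one {r : ℕ} (hr : 0 < r) (i : ℕ) : scaleIdx r i + 1 = r * (i + 1) := by
  have : 0 < r * (i + 1) := by positivity
  unfold scaleIdx
  omega

theorem scaleIdx_injective {r : ℕ} (hr : 0 < r) : Function.Injective (scaleIdx r) := by
  intro a b h
  have := congrArg (· + 1) h
  simp only [scaleIdx_add_one hr] at this
  have := Nat.eq_of_mul_eq_mul_left hr this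
  omega

theorem pleth_eq_rename (r : ℕ) (f : SymF) : pleth r f = rename (scaleIdx r) f := by
  rw [rename_eq_aeval]; rfl

theorem pderiv_pleth_of_not_dvd (r : ℕ) (hr : 0 < r) {i : ℕ} (hi : ¬ r ∣ i + 1) (g : SymF) :
    pderiv i (pleth r g) = 0 := by
  classical
  rw [pleth_eq_rename]
  refine pderiv_eq_zero_of_notMem_vars fun h => hi ?_
  obtain ⟨j, -, rfl⟩ := Finset.mem_image.mp (vars_rename _ _ h)
  exact ⟨j + 1, scaleIdx_add_one hr j⟩

theorem hall_C (a : ℚ) (g : SymF) : hall (C a) g = a * coeff 0 g := by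
  rw [hall_comm, C_apply, hall_monomial]
  simp [zfac, mul_comm]

/-- `plethAdj r` is adjoint to `pleth r`. -/
theorem hall_plethAdj {r : ℕ} (hr : 0 < r) (f g : SymF) :
    hall (plethAdj r f) g = hall f (pleth r g) := by
  induction f using MvPolynomial.induction_on generalizing g with
  | C a =>
    have : plethAdj r (C a) = C a := (plethAdj r).commutes a
    rw [this, hall_C, hall_C, pleth_eq_rename]
    congr 1
    exact (constantCoeff_rename (scaleIdx r) g).symm
  | add p q hp hq =>
    rw [map_add, ← hallForm_apply, ← hallForm_apply, map_add, map_add, LinearMap.add_apply,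
      LinearMap.add_apply]
    simp only [hallForm_apply, hp, hq]
  | mul_X p i ih =>
    rw [map_mul, plethAdj_X, hall_comm (p * X i), mul_comm p, hall_X_mul, hall_comm _ p]
    split_ifs with h
    · obtain ⟨c, hc⟩ := h
      rcases c with _ | j
      · simp at hc
      obtain rfl : i = scaleIdx r j := by
        have := scaleIdx_add_one hr j
        omega
      rw [hc, Nat.mul_div_cancel_left _ hr, Nat.add_sub_cancel, hall_comm,
        show plethAdj r p * ((r : SymF) * X j) = (r : ℚ) • (X j * plethAdj r p) by
          rw [Nat.cast_smul_eq_nsmul, nsmul_eq_mul]; ring,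
        hall_smul_right, hall_X_mul, hall_comm, ih, pleth_eq_rename, pleth_eq_rename,
        pderiv_rename (scaleIdx_injective hr)]
      have : ((scaleIdx r j : ℕ) : ℚ) + 1 = r * (j + 1) := by
        exact_mod_cast scaleIdx_add_one hr j
      rw [this, smul_eq_mul]
      ring
    · rw [pderiv_pleth_of_not_dvd r hr h, mul_zero, ← hallForm_apply, ← hallForm_apply]
      simp

theorem Derivation.leibniz_finsetProd {R A : Type*} [CommSemiring R] [CommSemiring A] [Algebra R A]
    (D : Derivation R A A) {ι : Type*} [DecidableEq ι] (s : Finset ι) (f : ι → A) :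
    D (∏ i ∈ s, f i) = ∑ i ∈ s, (∏ j ∈ s.erase i, f j) * D (f i) := by
  induction s using Finset.induction_on with
  | empty => simp
  | insert a s ha ih =>
    rw [Finset.prod_insert ha, D.leibniz, ih, Finset.sum_insert ha, Finset.erase_insert ha,
      smul_eq_mul, smul_eq_mul, Finset.mul_sum, add_comm]
    congr 1
    refine Finset.sum_congr rfl fun i hi => ?_
    have hia : i ≠ a := fun h => ha (h ▸ hi)
    rw [Finset.erase_insert_of_ne hia.symm,
      Finset.prod_insert (fun h => ha (Finset.mem_of_mem_erase h)), mul_assoc]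

/-- Evaluation of symmetric functions in `N` variables. -/
noncomputable def evalVars (N : ℕ) : SymF →ₐ[ℚ] MvPolynomial (Fin N) ℚ :=
  aeval fun k => ∑ i, X i ^ (k + 1)

theorem coeff_zero_hSym (n : ℕ) : coeff 0 (hSym n) = if n = 0 then 1 else 0 := by
  rw [coeff_hSym, map_zero]
  simp [zfac, eq_comm]

/-- The products of complete functions are dual to the monomials. -/
theorem hall_prod_hSym {N : ℕ} (α : Fin N →₀ ℕ) (g : SymF) :
    hall (∏ i, hSym (α i)) g = coeff α (evalVars N g) := by
  induction g using MvPolynomial.induction_on generalizing α with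
  | C a =>
    have : evalVars N (C a) = C a := (evalVars N).commutes a
    rw [this, hall_comm, hall_C, coeff_C, ← constantCoeff_eq, map_prod]
    simp only [constantCoeff_eq, coeff_zero_hSym]
    by_cases h : α = 0
    · subst h; simp
    · obtain ⟨i, hi⟩ := Finsupp.ne_iff.mp h
      rw [if_neg (Ne.symm h), Finset.prod_eq_zero (Finset.mem_univ i) (if_neg hi), mul_zero]
  | add p q hp hq => rw [hall_add_right, map_add, coeff_add, hp, hq]
  | mul_X p k ih =>
    rw [mul_comm, hall_X_mul, Derivation.leibniz_finsetProd, ← smul_eq_mul, ← hallForm_apply,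
      ← LinearMap.smul_apply, ← map_smul, Finset.smul_sum, map_mul, mul_comm, evalVars, aeval_X,
      ← evalVars, Finset.mul_sum, coeff_sum, map_sum, LinearMap.sum_apply]
    refine Finset.sum_congr rfl fun i _ => ?_
    rw [← mul_smul_comm, pderiv_hSym, X_pow_eq_monomial, coeff_mul_monomial', mul_one]
    have hle : Finsupp.single i (k + 1) ≤ α ↔ k + 1 ≤ α i := Finsupp.single_le_iff
    simp only [hle]
    split_ifs with h
    · rw [← ih, hallForm_apply, ← Finset.mul_prod_erase Finset.univ _ (Finset.mem_univ i), mul_comm]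
      congr 2
      · simp
      · refine Finset.prod_congr rfl fun j hj => ?_
        simp [Finset.ne_of_mem_erase hj]
    · simp

section PowerSeries

variable {N : ℕ}

/-- The geometric series `1 / (1 - y_i t)`. -/
noncomputable def geomVar (i : Fin N) : PowerSeries (MvPolynomial (Fin N) ℚ) :=
  PowerSeries.mk fun n => X i ^ n

theorem geomVar_mul (i : Fin N) :
    geomVar i * (1 - PowerSeries.C (X i) * PowerSeries.X) = 1 := by
  ext1 n
  rw [mul_sub, mul_one, ← mul_assoc, mul_comm _ (PowerSeries.C _), map_sub]
  cases n with
  | zero => simp [geomVar]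
  | succ n =>
    rw [PowerSeries.coeff_succ_mul_X, PowerSeries.coeff_C_mul]
    simp [geomVar, PowerSeries.coeff_one, pow_succ']

theorem derivative_geomVar (i : Fin N) :
    PowerSeries.derivative (MvPolynomial (Fin N) ℚ) (geomVar i) =
      geomVar i * (PowerSeries.C (X i) * geomVar i) := by
  have h := congrArg (PowerSeries.derivative (MvPolynomial (Fin N) ℚ)) (geomVar_mul i)
  rw [Derivation.leibniz, map_sub, Derivation.leibniz] at h
  simp only [smul_eq_mul, PowerSeries.derivative_X, PowerSeries.derivative_C,
    Derivation.map_one_eq_zero, mul_zero, add_zero, mul_one, zero_sub] at h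
  linear_combination (geomVar i) * h -
    (PowerSeries.derivative (MvPolynomial (Fin N) ℚ) (geomVar i)) * geomVar_mul i

theorem evalVars_hSym (n : ℕ) :
    evalVars N (hSym n) = PowerSeries.coeff n (∏ i, geomVar (N := N) i) := by
  refine map_hSym_of_newton (evalVars N)
    (fun n => PowerSeries.coeff n (∏ i, geomVar (N := N) i)) ?_ (fun n => ?_) n
  · rw [PowerSeries.coeff_zero_eq_constantCoeff_apply, map_prod]
    refine Finset.prod_eq_one fun i _ => ?_
    rw [← PowerSeries.coeff_zero_eq_constantCoeff_apply, geomVar, PowerSeries.coeff_mk, pow_zero]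
  · cases n with
    | zero => simp
    | succ n =>
      have h := Derivation.leibniz_finsetProd
        (PowerSeries.derivative (MvPolynomial (Fin N) ℚ)) Finset.univ (geomVar (N := N))
      have h2 : PowerSeries.derivative (MvPolynomial (Fin N) ℚ) (∏ i, geomVar (N := N) i) =
          (∑ i, PowerSeries.C (X i) * geomVar i) * ∏ i, geomVar (N := N) i := by
        rw [h, Finset.sum_mul]
        refine Finset.sum_congr rfl fun i _ => ?_
        rw [derivative_geomVar, ← Finset.mul_prod_erase Finset.univ _ (Finset.mem_univ i)]
        ring
      have h3 := congrArg (PowerSeries.coeff n) h2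
      rw [PowerSeries.coeff_derivative, PowerSeries.coeff_mul,
        Finset.Nat.sum_antidiagonal_eq_sum_range_succ
          (fun a b => PowerSeries.coeff a (∑ i, PowerSeries.C (X i) * geomVar (N := N) i) *
            PowerSeries.coeff b (∏ i, geomVar (N := N) i))] at h3
      rw [Nat.cast_smul_eq_nsmul, nsmul_eq_mul, Nat.cast_succ, mul_comm, h3]
      refine Finset.sum_congr rfl fun k _ => ?_
      rw [Nat.add_sub_cancel]
      congr 1
      simp [evalVars, geomVar, pow_succ', map_sum]

end PowerSeries

/-- The Jacobi–Trudi determinant attached to a family of bead positions. -/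
noncomputable def jacobiTrudi {N : ℕ} (b : Fin N → ℕ) : SymF :=
  Matrix.det (Matrix.of fun i j : Fin N => hz ((b i : ℤ) - (j : ℤ)))

/-- The alternant `det (y_j ^ b_i)`. -/
noncomputable def alternant {N : ℕ} (b : Fin N → ℕ) : MvPolynomial (Fin N) ℚ :=
  Matrix.det (Matrix.of fun i j : Fin N => X j ^ b i)

theorem hz_natCast_sub (a c : ℕ) :
    hz ((a : ℤ) - (c : ℤ)) = if c ≤ a then hSym (a - c) else 0 := by
  unfold hz
  split_ifs with h1 h2 h2
  · omega
  · rfl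
  · congr 1
    omega
  · omega

section
variable {N : ℕ}

/-- The polynomial `∏_{i ≠ j} (1 - y_i t)`. -/
noncomputable def cofactorPoly (j : Fin N) : Polynomial (MvPolynomial (Fin N) ℚ) :=
  ∏ i ∈ Finset.univ.erase j, (1 - Polynomial.C (X i) * Polynomial.X)

theorem cofactorPoly_coeff_eq_zero (j : Fin N) {k : ℕ} (hk : N ≤ k) :
    (cofactorPoly j).coeff k = 0 := by
  refine Polynomial.coeff_eq_zero_of_natDegree_lt (lt_of_le_of_lt
    (Polynomial.natDegree_prod_le _ _) (lt_of_le_of_lt (Finset.sum_le_card_nsmul _ _ 1 ?_) ?_))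
  · intro i _
    refine (Polynomial.natDegree_sub_le _ _).trans ?_
    simp
  · have := j.pos
    simp
    omega

theorem cofactorPoly_mul_prod (j : Fin N) :
    (cofactorPoly j : PowerSeries (MvPolynomial (Fin N) ℚ)) * ∏ i, geomVar i = geomVar j := by
  have h1 : (cofactorPoly j : PowerSeries (MvPolynomial (Fin N) ℚ)) =
      ∏ i ∈ Finset.univ.erase j, (1 - PowerSeries.C (X i) * PowerSeries.X) := by
    rw [cofactorPoly, ← Polynomial.coeToPowerSeries.ringHom_apply, map_prod]
    simp
  rw [h1, ← Finset.mul_prod_erase Finset.univ _ (Finset.mem_univ j), mul_left_comm,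
    ← Finset.prod_mul_distrib, Finset.prod_eq_one, mul_one]
  intro i _
  rw [mul_comm, geomVar_mul]

theorem sum_evalVars_hz_mul_cofactor (a : ℕ) (j : Fin N) :
    ∑ k : Fin N, evalVars N (hz ((a : ℤ) - (k : ℤ))) * (cofactorPoly j).coeff k = X j ^ a := by
  have h := congrArg (PowerSeries.coeff a) (cofactorPoly_mul_prod j)
  rw [PowerSeries.coeff_mul, Finset.Nat.sum_antidiagonal_eq_sum_range_succ
    (fun x y => PowerSeries.coeff x (cofactorPoly j : PowerSeries (MvPolynomial (Fin N) ℚ)) *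
      PowerSeries.coeff y (∏ i, geomVar (N := N) i)), geomVar, PowerSeries.coeff_mk] at h
  rw [← h, Fin.sum_univ_eq_sum_range
    (fun k => evalVars N (hz ((a : ℤ) - (k : ℤ))) * (cofactorPoly j).coeff k)]
  have h1 : ∀ k, evalVars N (hz ((a : ℤ) - (k : ℕ))) * (cofactorPoly j).coeff k =
      if k ≤ a then PowerSeries.coeff k (cofactorPoly j : PowerSeries (MvPolynomial (Fin N) ℚ)) *
        PowerSeries.coeff (a - k) (∏ i, geomVar (N := N) i) else 0 := by
    intro k
    rw [hz_natCast_sub]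
    split_ifs
    · rw [evalVars_hSym, Polynomial.coeff_coe, mul_comm]
    · rw [map_zero, zero_mul]
  rw [Finset.sum_subset (Finset.range_subset_range.mpr (le_max_left N (a + 1)))]
  · rw [Finset.sum_congr rfl fun k _ => h1 k, ← Finset.sum_filter]
    refine Finset.sum_congr ?_ fun _ _ => rfl
    ext k
    simp
    omega
  · intro k _ hk
    rw [cofactorPoly_coeff_eq_zero j (by simpa using hk), mul_zero]

theorem evalVars_det (b : Fin N → ℕ) :
    alternant b = evalVars N (jacobiTrudi b) *
      Matrix.det (Matrix.of fun k j : Fin N => (cofactorPoly j).coeff k) := by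
  rw [jacobiTrudi, AlgHom.map_det, ← Matrix.det_mul, alternant]
  congr 1
  ext1 i j
  rw [Matrix.mul_apply]
  exact (sum_evalVars_hz_mul_cofactor (b i) j).symm

theorem jacobiTrudi_id : jacobiTrudi (fun i : Fin N => (i : ℕ)) = 1 := by
  rw [jacobiTrudi, Matrix.det_of_isLowerTriangular]
  · refine Finset.prod_eq_one fun i _ => ?_
    rw [Matrix.of_apply, hz_natCast_sub, if_pos le_rfl, Nat.sub_self, hSym_zero]
  · intro i j hij
    rw [Matrix.of_apply, hz_natCast_sub, if_neg]
    exact not_le.mpr hij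

/-- The bialternant formula. -/
theorem alternant_eq (b : Fin N → ℕ) :
    alternant b = alternant (fun i : Fin N => (i : ℕ)) * evalVars N (jacobiTrudi b) := by
  rw [evalVars_det, evalVars_det (fun i : Fin N => (i : ℕ)), jacobiTrudi_id, map_one, one_mul,
    mul_comm]

theorem monomial_equivFunOnFinite (s : Fin N → ℕ) :
    ∏ i, (X i : MvPolynomial (Fin N) ℚ) ^ s i = monomial (Finsupp.equivFunOnFinite.symm s) 1 := by
  rw [monomial_eq, Finsupp.prod_fintype _ _ (by simp)]
  simp

theorem hall_prod_hz (b s : Fin N → ℕ) (g : SymF) :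
    hall (∏ i, hz ((b i : ℤ) - (s i : ℤ))) g =
      coeff (Finsupp.equivFunOnFinite.symm b) ((∏ i, X i ^ s i) * evalVars N g) := by
  rw [monomial_equivFunOnFinite, coeff_monomial_mul', one_mul]
  simp only [hz_natCast_sub]
  split_ifs with h
  · rw [← hall_prod_hSym]
    congr 1
    refine Finset.prod_congr rfl fun i _ => ?_
    rw [if_pos (by simpa using h i)]
    simp
  · rw [Finsupp.le_def] at h
    push Not at h
    obtain ⟨i, hi⟩ := h
    rw [Finset.prod_eq_zero (Finset.mem_univ i), ← hallForm_apply, map_zero, LinearMap.zero_apply]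
    rw [if_neg (by simpa using hi)]

theorem hall_jacobiTrudi (b : Fin N → ℕ) (g : SymF) :
    hall (jacobiTrudi b) g = coeff (Finsupp.equivFunOnFinite.symm b)
      (alternant (fun i : Fin N => (i : ℕ)) * evalVars N g) := by
  rw [jacobiTrudi, ← Matrix.det_transpose, Matrix.det_apply, alternant, Matrix.det_apply,
    Finset.sum_mul, coeff_sum, ← hallForm_apply, map_sum, LinearMap.sum_apply]
  refine Finset.sum_congr rfl fun σ _ => ?_
  simp only [Matrix.transpose_apply, Matrix.of_apply, Units.smul_def, smul_mul_assoc, map_zsmul,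
    LinearMap.smul_apply, hallForm_apply, hall_prod_hz b (fun i => (σ i : ℕ)) g]
  rcases Int.units_eq_one_or (Equiv.Perm.sign σ) with h | h <;> simp [h]

theorem hall_jacobiTrudi_jacobiTrudi {b c : Fin N → ℕ} (hb : StrictMono b) (hc : StrictMono c) :
    hall (jacobiTrudi b) (jacobiTrudi c) = if b = c then 1 else 0 := by
  rw [hall_jacobiTrudi, ← alternant_eq, alternant, Matrix.det_apply, coeff_sum]
  simp only [Matrix.of_apply]
  have key : ∀ σ : Equiv.Perm (Fin N), coeff (Finsupp.equivFunOnFinite.symm b)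
      (Equiv.Perm.sign σ • ∏ i, (X i : MvPolynomial (Fin N) ℚ) ^ c (σ i)) =
      if b = c ∧ σ = 1 then 1 else 0 := by
    intro σ
    rw [monomial_equivFunOnFinite fun i => c (σ i)]
    have h1 : ((fun i => c (σ i)) = b) ↔ (b = c ∧ σ = 1) := by
      constructor
      · intro h
        have hbc : b = c := by
          refine ((StrictMono.range_inj hb hc).mp ?_)
          rw [← h]
          exact σ.surjective.range_comp c
        refine ⟨hbc, ?_⟩
        ext1 i
        exact hc.injective ((congrFun h i).trans (congrFun hbc i))
      · rintro ⟨rfl, rfl⟩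
        rfl
    split_ifs with h
    · obtain ⟨rfl, rfl⟩ := h
      simp
    · rw [← h1] at h
      have : coeff (Finsupp.equivFunOnFinite.symm b) (monomial
          (Finsupp.equivFunOnFinite.symm fun i => c (σ i)) (1 : ℚ)) = 0 := by
        rw [coeff_monomial, if_neg]
        exact fun h' => h (Finsupp.equivFunOnFinite.symm.injective h')
      rcases Int.units_eq_one_or (Equiv.Perm.sign σ) with h | h <;> simp [h, this]
  rw [Finset.sum_congr rfl fun σ _ => key σ]
  by_cases h : b = c <;> simp [h]
end

namespace Ptn

theorem ext_parts {l l' : Ptn} (h : l.parts = l'.parts) : l = l' := by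
  cases l; cases l'; congr

/-- The parts in weakly decreasing order. -/
def sorted (l : Ptn) : List ℕ := (l.parts.sort (· ≤ ·)).reverse

theorem coe_sorted (l : Ptn) : (l.sorted : Multiset ℕ) = l.parts := by
  rw [sorted, Multiset.coe_reverse, Multiset.sort_eq]

theorem length_sorted (l : Ptn) : l.sorted.length = l.length := by
  rw [sorted, List.length_reverse, Multiset.length_sort, length]

theorem pairwise_sorted (l : Ptn) : l.sorted.Pairwise (· ≥ ·) := by
  rw [sorted, List.pairwise_reverse]
  exact Multiset.pairwise_sort _ _

theorem part_eq_getD (l : Ptn) (i : ℕ) : l.part i = l.sorted.getD i 0 := rfl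

theorem part_eq_getElem (l : Ptn) {i : ℕ} (h : i < l.sorted.length) : l.part i = l.sorted[i] := by
  rw [part_eq_getD, List.getD_eq_getElem _ _ h]

theorem part_eq_zero (l : Ptn) {i : ℕ} (h : l.length ≤ i) : l.part i = 0 := by
  rw [part_eq_getD, List.getD_eq_default _ _ (by rwa [length_sorted])]

theorem part_antitone (l : Ptn) : Antitone l.part := by
  intro i j hij
  by_cases hj : j < l.sorted.length
  · rcases hij.eq_or_lt with rfl | hlt
    · rfl
    · rw [part_eq_getElem l hj, part_eq_getElem l (hlt.trans hj)]
      exact List.pairwise_iff_getElem.mp l.pairwise_sorted i j _ hj hlt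
  · rw [part_eq_zero l (by rw [← length_sorted]; omega)]
    exact Nat.zero_le _

theorem map_part_range (l : Ptn) : (Multiset.range l.length).map l.part = l.parts := by
  rw [← coe_sorted, ← length_sorted, Multiset.range, Multiset.map_coe]
  congr 1
  refine List.ext_getElem (by simp) fun i h1 h2 => ?_
  rw [List.getElem_map, List.getElem_range, part_eq_getElem l h2]

theorem sum_part_range (l : Ptn) : ∑ i ∈ Finset.range l.length, l.part i = l.size := by
  rw [size, ← map_part_range]; rfl

theorem filter_map_part_range (l : Ptn) {N : ℕ} (h : l.length ≤ N) :
    ((Multiset.range N).map l.part).filter (fun x => 0 < x) = l.parts := by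
  induction N, h using Nat.le_induction with
  | base =>
    rw [map_part_range, Multiset.filter_eq_self]
    exact l.pos
  | succ n hn ih =>
    rw [Multiset.range_succ, Multiset.map_cons, Multiset.filter_cons_of_neg _
      (by rw [part_eq_zero l hn]; exact lt_irrefl 0), ih]

theorem of_map_part (l : Ptn) {N : ℕ} (h : l.length ≤ N) :
    of ((Multiset.range N).map l.part) = l :=
  ext_parts (filter_map_part_range l h)

theorem ext_part {l l' : Ptn} {N : ℕ} (hl : l.length ≤ N) (hl' : l'.length ≤ N)
    (h : ∀ i < N, l.part i = l'.part i) : l = l' := by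
  rw [← of_map_part l hl, ← of_map_part l' hl']
  congr 1
  exact Multiset.map_congr rfl fun i hi => h i (Multiset.mem_range.mp hi)

theorem length_of_le (s : Multiset ℕ) : (of s).length ≤ Multiset.card s :=
  Multiset.card_le_card (Multiset.filter_le _ _)

theorem filter_pos_map_range {f : ℕ → ℕ} {N : ℕ} (hf : ∀ i j, i ≤ j → j < N → f j ≤ f i) :
    ∃ m ≤ N, ((Multiset.range N).map f).filter (fun x => 0 < x) = (Multiset.range m).map f ∧
      ∀ i, m ≤ i → i < N → f i = 0 := by
  induction N with
  | zero => exact ⟨0, le_rfl, by simp, by simp⟩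
  | succ n ih =>
    rcases Nat.eq_zero_or_pos (f n) with h0 | hpos
    · obtain ⟨m, hm, h1, h2⟩ := ih fun i j hij hj => hf i j hij (hj.trans n.lt_succ_self)
      refine ⟨m, by omega, ?_, fun i hi hin => ?_⟩
      · rw [Multiset.range_succ, Multiset.map_cons, Multiset.filter_cons_of_neg _ (by omega), h1]
      · rcases (Nat.lt_succ_iff.mp hin).eq_or_lt with rfl | hlt
        · exact h0
        · exact h2 i hi hlt
    · refine ⟨n + 1, le_rfl, ?_, by omega⟩
      rw [Multiset.filter_eq_self]
      intro x hx
      obtain ⟨i, hi, rfl⟩ := Multiset.mem_map.mp hx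
      exact hpos.trans_le (hf i n (Nat.lt_succ_iff.mp (Multiset.mem_range.mp hi)) n.lt_succ_self)

theorem part_of_map {f : ℕ → ℕ} {N : ℕ} (hf : ∀ i j, i ≤ j → j < N → f j ≤ f i) {i : ℕ}
    (hi : i < N) : (of ((Multiset.range N).map f)).part i = f i := by
  obtain ⟨m, hm, h1, h2⟩ := filter_pos_map_range hf
  have hs : (of ((Multiset.range N).map f)).sorted = (List.range m).map f := by
    refine List.Perm.eq_of_pairwise' (r := (· ≥ ·)) (pairwise_sorted _) ?_ ?_
    · rw [List.pairwise_map]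
      refine List.pairwise_lt_range.imp_of_mem fun {a b} _ hb hab => ?_
      exact hf a b hab.le ((List.mem_range.mp hb).trans_le hm)
    · rw [← Multiset.coe_eq_coe, coe_sorted]
      exact h1
  rw [part_eq_getD, hs]
  by_cases him : i < m
  · rw [List.getD_eq_getElem _ _ (by simpa using him)]
    simp
  · rw [List.getD_eq_default _ _ (by simpa using him), h2 i (by omega) hi]

end Ptn

/-- The bead positions of `l` with `N` beads, in increasing order. -/
def beads (l : Ptn) (N : ℕ) (i : Fin N) : ℕ := l.part (N - 1 - i) + i

theorem beads_strictMono (l : Ptn) (N : ℕ) : StrictMono (beads l N) := by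
  intro i j hij
  have h : l.part (N - 1 - i) ≤ l.part (N - 1 - j) := l.part_antitone (by omega)
  have : (i : ℕ) < j := hij
  unfold beads
  omega

theorem beads_injective {l l' : Ptn} {N : ℕ} (hl : l.length ≤ N) (hl' : l'.length ≤ N)
    (h : beads l N = beads l' N) : l = l' := by
  refine Ptn.ext_part hl hl' fun i hi => ?_
  have := congrFun h ⟨N - 1 - i, by omega⟩
  simp only [beads, show N - 1 - (N - 1 - i) = i by omega] at this
  omega

theorem det_hz_part_eq_schur (l : Ptn) {N : ℕ} (h : l.length ≤ N) :
    Matrix.det (Matrix.of fun i j : Fin N => hz ((l.part i : ℤ) + (j : ℤ) - (i : ℤ))) =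
      schur l := by
  induction N, h using Nat.le_induction with
  | base => rfl
  | succ n hn ih =>
    rw [Matrix.det_succ_row _ (Fin.last n), Fin.sum_univ_castSucc, Finset.sum_eq_zero, zero_add]
    · rw [← ih]
      simp only [Fin.val_last, Fin.succAbove_last, Matrix.of_apply, l.part_eq_zero hn]
      rw [show hz (((0 : ℕ) : ℤ) + (n : ℤ) - (n : ℤ)) = 1 by
        simp [hz, hSym_zero], ← two_mul, pow_mul]
      simp
      rfl
    · intro j _
      have : hz (((0 : ℕ) : ℤ) + ((j : ℕ) : ℤ) - (n : ℤ)) = 0 := if_pos (by omega)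
      simp only [Fin.val_last, Matrix.of_apply, l.part_eq_zero hn, Fin.val_castSucc, this]
      simp

theorem schur_eq_jacobiTrudi (l : Ptn) {N : ℕ} (h : l.length ≤ N) :
    schur l = jacobiTrudi (beads l N) := by
  rw [jacobiTrudi, ← det_hz_part_eq_schur l h,
    ← Matrix.det_submatrix_equiv_self Fin.revPerm (Matrix.of fun i j : Fin N => hz _)]
  congr 1
  ext1 i j
  simp only [Matrix.submatrix_apply, Matrix.of_apply, beads, Fin.revPerm_apply, Fin.val_rev]
  rw [show N - 1 - (i : ℕ) = N - (i + 1) by omega]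
  congr 1
  omega

theorem hall_schur_schur (l l' : Ptn) [Decidable (l = l')] :
    hall (schur l) (schur l') = if l = l' then 1 else 0 := by
  have h1 := le_max_left l.length l'.length
  have h2 := le_max_right l.length l'.length
  rw [schur_eq_jacobiTrudi l h1, schur_eq_jacobiTrudi l' h2,
    hall_jacobiTrudi_jacobiTrudi (beads_strictMono _ _) (beads_strictMono _ _)]
  congr 1
  exact propext ⟨beads_injective h1 h2, fun h => h ▸ rfl⟩

theorem card_filter_lt_orderEmb {B : Finset ℕ} {N : ℕ} (hB : B.card = N) (i : Fin N) :
    (B.filter fun q => q < B.orderEmbOfFin hB i).card = i := by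
  have : B.filter (fun q => q < B.orderEmbOfFin hB i) =
      (Finset.Iio i).map (B.orderEmbOfFin hB).toEmbedding := by
    ext q
    simp only [Finset.mem_filter, Finset.mem_map, Finset.mem_Iio]
    constructor
    · rintro ⟨hq, hlt⟩
      rw [← Finset.mem_coe, ← Finset.range_orderEmbOfFin B hB] at hq
      obtain ⟨j, rfl⟩ := hq
      exact ⟨j, by simpa using hlt, rfl⟩
    · rintro ⟨j, hj, rfl⟩
      exact ⟨Finset.orderEmbOfFin_mem _ _ _, by simpa using hj⟩
  rw [this, Finset.card_map, Fin.card_Iio]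

theorem le_orderEmbOfFin {B : Finset ℕ} {N : ℕ} (hB : B.card = N) (i : Fin N) :
    (i : ℕ) ≤ B.orderEmbOfFin hB i := by
  rw [← card_filter_lt_orderEmb hB i]
  refine (Finset.card_le_card (t := Finset.range (B.orderEmbOfFin hB i)) fun q hq => ?_).trans
    (Finset.card_range _).le
  exact Finset.mem_range.mpr (Finset.mem_filter.mp hq).2

theorem ptnOfBeads_eq {B : Finset ℕ} {N : ℕ} (hB : B.card = N) :
    ptnOfBeads B = Ptn.of ((Multiset.range N).map fun i =>
      if h : N - 1 - i < N then B.orderEmbOfFin hB ⟨N - 1 - i, h⟩ - (N - 1 - i) else 0) := by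
  unfold ptnOfBeads
  congr 1
  have h1 : B.val = (Finset.univ : Finset (Fin N)).val.map (B.orderEmbOfFin hB) := by
    have := congrArg Finset.val (Finset.map_orderEmbOfFin_univ B hB)
    rw [← this]; rfl
  have h2 : Multiset.range N =
      (Finset.univ : Finset (Fin N)).val.map (fun i : Fin N => N - 1 - (i : ℕ)) := by
    refine (Multiset.Nodup.ext (Multiset.nodup_range N) ?_).2 fun a => ?_
    · refine Multiset.Nodup.map_on (fun i _ j _ hij => ?_) Finset.univ.nodup
      ext
      omega
    · simp only [Multiset.mem_range, Multiset.mem_map, Finset.mem_val, Finset.mem_univ, true_and]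
      exact ⟨fun h => ⟨⟨N - 1 - a, by omega⟩, by simp only; omega⟩, fun ⟨i, hi⟩ => by omega⟩
  rw [h1, h2, Multiset.map_map, Multiset.map_map]
  refine Multiset.map_congr rfl fun i _ => ?_
  have hi : N - 1 - (N - 1 - (i : ℕ)) = i := by omega
  simp only [Function.comp_apply, hi, i.isLt, dite_true, Fin.eta]
  rw [card_filter_lt_orderEmb]

theorem schur_ptnOfBeads {B : Finset ℕ} {N : ℕ} (hB : B.card = N) :
    schur (ptnOfBeads B) = jacobiTrudi (B.orderEmbOfFin hB) := by
  rw [schur_eq_jacobiTrudi (N := N)]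
  · congr 1
    ext i
    rw [beads, ptnOfBeads_eq hB, Ptn.part_of_map]
    · have hi : N - 1 - (N - 1 - (i : ℕ)) = i := by omega
      have := le_orderEmbOfFin hB i
      simp only [hi, i.isLt, dite_true, Fin.eta]
      omega
    · intro a b hab hb
      rw [dif_pos (by omega), dif_pos (by omega)]
      have key : ∀ (d : ℕ) (x y : Fin N), (y : ℕ) = x + d →
          B.orderEmbOfFin hB x + d ≤ B.orderEmbOfFin hB y := by
        intro d
        induction d with
        | zero => intro x y h; rw [show y = x from Fin.ext h]; rfl
        | succ d ih =>
          intro x y h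
          have h1 := ih x ⟨x + d, by omega⟩ rfl
          have h2 : B.orderEmbOfFin hB ⟨x + d, by omega⟩ < B.orderEmbOfFin hB y :=
            (B.orderEmbOfFin hB).strictMono (by rw [Fin.lt_def]; simp; omega)
          omega
      have := key (b - a) ⟨N - 1 - b, by omega⟩ ⟨N - 1 - a, by omega⟩ (by simp; omega)
      omega
    · omega
  · rw [ptnOfBeads]
    refine (Ptn.length_of_le _).trans ?_
    rw [Multiset.card_map]
    exact hB.le

theorem intCast_weight_symWt (d : ℕ →₀ ℕ) :
    Finsupp.weight (fun i => (symWt i : ℤ)) d = (Finsupp.weight symWt d : ℤ) := by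
  simp [Finsupp.weight_apply, Finsupp.sum]

theorem isWeightedHomogeneous_hz (k : ℤ) :
    IsWeightedHomogeneous (fun i => (symWt i : ℤ)) (hz k) k := by
  intro d hd
  rw [hz] at hd
  split_ifs at hd with h
  · simp at hd
  · rw [coeff_hSym] at hd
    split_ifs at hd with h'
    · rw [intCast_weight_symWt, h']
      omega
    · simp at hd

theorem weight_of_coeff_schur_ne_zero {l : Ptn} {d : ℕ →₀ ℕ} (h : coeff d (schur l) ≠ 0) :
    Finsupp.weight symWt d = l.size := by
  have key : IsWeightedHomogeneous (fun i => (symWt i : ℤ)) (schur l) (l.size : ℤ) := by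
    rw [schur, Matrix.det_apply]
    refine IsWeightedHomogeneous.sum _ _ _ fun σ _ => ?_
    refine Submodule.smul_of_tower_mem (weightedHomogeneousSubmodule ℚ _ _) _ ?_
    rw [mem_weightedHomogeneousSubmodule]
    have := IsWeightedHomogeneous.prod (R := ℚ) (w := fun i => (symWt i : ℤ)) Finset.univ _ _
      fun i (_ : i ∈ (Finset.univ : Finset (Fin l.length))) =>
        isWeightedHomogeneous_hz ((l.part (σ i) : ℤ) + (i : ℤ) - (σ i : ℤ))
    simp only [Matrix.of_apply]
    convert this using 1
    rw [Finset.sum_sub_distrib, Finset.sum_add_distrib, Equiv.sum_comp σ (fun i => (i : ℤ)),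
      Equiv.sum_comp σ (fun i => (l.part i : ℤ)), ← l.sum_part_range,
      Finset.sum_range]
    push_cast
    ring
  have := key h
  rw [intCast_weight_symWt] at this
  exact_mod_cast this

theorem weight_of_coeff_pleth_ne_zero {r n : ℕ} (hr : 0 < r) {f : SymF}
    (hf : ∀ d, coeff d f ≠ 0 → Finsupp.weight symWt d = n) {d : ℕ →₀ ℕ}
    (h : coeff d (pleth r f) ≠ 0) : Finsupp.weight symWt d = r * n := by
  rw [pleth_eq_rename] at h
  obtain ⟨u, rfl, hu⟩ := coeff_rename_ne_zero _ _ _ h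
  rw [← hf u hu, Finsupp.weight_apply, Finsupp.weight_apply,
    Finsupp.sum_mapDomain_index (by simp) (by simp [add_mul]), Finsupp.mul_sum]
  refine Finsupp.sum_congr fun i _ => ?_
  simp only [symWt, scaleIdx_add_one hr, smul_eq_mul]
  ring

/-- A partition of `n`, seen as a `Ptn`. -/
def Nat.Partition.toPtn {n : ℕ} (ρ : n.Partition) : Ptn := ⟨ρ.parts, fun _ hx => ρ.parts_pos hx⟩

theorem Nat.Partition.toPtn_injective {n : ℕ} :
    Function.Injective (Nat.Partition.toPtn (n := n)) := fun _ _ h =>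
  Nat.Partition.ext (congrArg Ptn.parts h)

theorem Nat.Partition.size_toPtn {n : ℕ} (ρ : n.Partition) : ρ.toPtn.size = n := ρ.parts_sum

theorem Nat.Partition.range_toPtn (n : ℕ) :
    Set.range (Nat.Partition.toPtn (n := n)) = {l | l.size = n} := by
  ext l
  exact ⟨fun ⟨ρ, h⟩ => h ▸ ρ.size_toPtn, fun h => ⟨⟨l.parts, fun hx => l.pos _ hx, h⟩, rfl⟩⟩

/-- The exponent vector of the power sum product indexed by a partition. -/
noncomputable def Nat.Partition.expVec {n : ℕ} (ρ : n.Partition) : ℕ →₀ ℕ :=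
  Multiset.toFinsupp (ρ.parts.map (· - 1))

theorem Nat.Partition.expVec_injective {n : ℕ} :
    Function.Injective (Nat.Partition.expVec (n := n)) := fun ρ ρ' h => by
  have h' : ρ.parts.map (· - 1) = ρ'.parts.map (· - 1) := Multiset.toFinsupp.injective h
  refine Nat.Partition.ext ?_
  rw [← map_add_map_sub fun _ hx => ρ.parts_pos hx, h', map_add_map_sub fun _ hx => ρ'.parts_pos hx]

theorem Nat.Partition.mem_range_expVec {n : ℕ} {d : ℕ →₀ ℕ} (h : Finsupp.weight symWt d = n) :
    ∃ ρ : n.Partition, ρ.expVec = d := by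
  refine ⟨⟨(Finsupp.toMultiset d).map (· + 1), fun hx => ?_, (sum_map_succ d).trans h⟩, ?_⟩
  · obtain ⟨a, _, rfl⟩ := Multiset.mem_map.mp hx
    exact Nat.succ_pos a
  · simp [expVec, Multiset.map_map]

theorem hall_eq_sum_partition {n : ℕ} {f : SymF}
    (hf : ∀ d, coeff d f ≠ 0 → Finsupp.weight symWt d = n) (g : SymF) :
    hall f g = ∑ ρ : n.Partition, coeff ρ.expVec f * coeff ρ.expVec g * zfac ρ.expVec := by
  classical
  rw [hall_eq_sum (T := Finset.univ.image (Nat.Partition.expVec (n := n))),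
    Finset.sum_image fun _ _ _ _ h => Nat.Partition.expVec_injective h]
  intro d hd
  obtain ⟨ρ, hρ⟩ := Nat.Partition.mem_range_expVec (hf d (mem_support_iff.mp hd))
  exact Finset.mem_image.mpr ⟨ρ, Finset.mem_univ _, hρ⟩

theorem eq_sum_hall_schur {n : ℕ} {f : SymF}
    (hf : ∀ d, coeff d f ≠ 0 → Finsupp.weight symWt d = n) :
    f = ∑ ρ : n.Partition, hall (schur ρ.toPtn) f • schur ρ.toPtn := by
  classical
  have hs : ∀ ρ : n.Partition, ∀ d, coeff d (schur ρ.toPtn) ≠ 0 → Finsupp.weight symWt d = n :=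
    fun ρ d h => (weight_of_coeff_schur_ne_zero h).trans ρ.size_toPtn
  let M : Matrix n.Partition n.Partition ℚ := .of fun ρ τ => coeff τ.expVec (schur ρ.toPtn)
  let M' : Matrix n.Partition n.Partition ℚ :=
    .of fun τ ρ => coeff τ.expVec (schur ρ.toPtn) * zfac τ.expVec
  have h1 : M * M' = 1 := by
    ext ρ ρ'
    have := hall_eq_sum_partition (hs ρ) (schur ρ'.toPtn)
    rw [hall_schur_schur] at this
    simp only [Nat.Partition.toPtn_injective.eq_iff] at this
    rw [Matrix.one_apply, this, Matrix.mul_apply]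
    exact Finset.sum_congr rfl fun τ _ => (mul_assoc _ _ _).symm
  have h2 : M' * M = 1 := mul_eq_one_comm.mp h1
  ext d
  rw [coeff_sum]
  simp only [coeff_smul, smul_eq_mul]
  by_cases hd : Finsupp.weight symWt d = n
  · obtain ⟨τ, rfl⟩ := Nat.Partition.mem_range_expVec hd
    have h3 : ∀ ρ : n.Partition, hall (schur ρ.toPtn) f =
        ∑ κ : n.Partition, coeff κ.expVec f * M' κ ρ := fun ρ => by
      rw [hall_eq_sum_partition (hs ρ)]
      exact Finset.sum_congr rfl fun κ _ => by simp only [M', Matrix.of_apply]; ring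
    simp only [h3, Finset.sum_mul]
    rw [Finset.sum_comm]
    have h4 : ∀ κ : n.Partition, ∑ ρ : n.Partition,
        coeff κ.expVec f * M' κ ρ * coeff τ.expVec (schur ρ.toPtn) =
        coeff κ.expVec f * (if κ = τ then 1 else 0) := fun κ => by
      rw [← Matrix.one_apply, ← h2, Matrix.mul_apply, Finset.mul_sum]
      exact Finset.sum_congr rfl fun ρ _ => mul_assoc _ _ _
    simp [h4]
  · rw [by_contra fun h => hd (hf d h), eq_comm]
    refine Finset.sum_eq_zero fun ρ _ => ?_
    rw [by_contra fun h => hd (hs ρ d h), mul_zero]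

theorem sign_eq_neg_one_pow_inversions {B : Finset ℕ} {N : ℕ} (hB : B.card = N) (key : ℕ → ℕ)
    (σ : Equiv.Perm (Fin N)) (hσ : ∀ i, (σ i : ℕ) = key (B.orderEmbOfFin hB i)) :
    Equiv.Perm.sign σ = (-1) ^ inversions key B := by
  rw [σ.sign_eq_prod_prod_Ioi, Finset.prod_sigma', Finset.prod_ite, Finset.prod_const_one, one_mul,
    Finset.prod_const]
  congr 1
  refine Finset.card_bij (fun x _ => (B.orderEmbOfFin hB x.1, B.orderEmbOfFin hB x.2)) ?_ ?_ ?_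
  · rintro ⟨i, j⟩ h
    simp only [Finset.mem_filter, Finset.mem_sigma, Finset.mem_univ, Finset.mem_Ioi, true_and,
      not_lt] at h
    simp only [Finset.mem_filter, Finset.mem_product, Finset.orderEmbOfFin_mem, true_and,
      OrderEmbedding.lt_iff_lt, ← hσ]
    refine ⟨h.1, ?_⟩
    have h1 : σ j ≠ σ i := fun h' => h.1.ne' (σ.injective h')
    exact lt_of_le_of_ne h.2 (Fin.val_ne_of_ne h1)
  · rintro ⟨i, j⟩ _ ⟨i', j'⟩ _ h
    simpa using h
  · rintro ⟨p, q⟩ h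
    simp only [Finset.mem_filter, Finset.mem_product] at h
    obtain ⟨⟨hp, hq⟩, hpq, hk⟩ := h
    obtain ⟨i, rfl⟩ : p ∈ Set.range (B.orderEmbOfFin hB) := by
      rwa [Finset.range_orderEmbOfFin]
    obtain ⟨j, rfl⟩ : q ∈ Set.range (B.orderEmbOfFin hB) := by
      rwa [Finset.range_orderEmbOfFin]
    refine ⟨⟨i, j⟩, ?_, rfl⟩
    simp only [Finset.mem_filter, Finset.mem_sigma, Finset.mem_univ, Finset.mem_Ioi, true_and,
      not_lt]
    refine ⟨by simpa using hpq, Fin.le_def.mpr ?_⟩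
    rw [hσ, hσ]
    exact hk.le

theorem orderEmbOfFin_card_filter_lt {S : Finset ℕ} {N : ℕ} (hS : S.card = N) {x : ℕ}
    (hx : x ∈ S) (h : (S.filter fun q => q < x).card < N) :
    S.orderEmbOfFin hS ⟨(S.filter fun q => q < x).card, h⟩ = x := by
  obtain ⟨i, rfl⟩ : x ∈ Set.range (S.orderEmbOfFin hS) := by
    rwa [Finset.range_orderEmbOfFin]
  congr 1
  exact Fin.ext (card_filter_lt_orderEmb hS i)

/-- The levels of the beads of `B` on the `k`-th runner. -/
def levels (r : ℕ) (B : Finset ℕ) (k : ℕ) : Finset ℕ :=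
  (B.filter fun q => q % r = k).image (· / r)

theorem injOn_div_filter_mod (r k : ℕ) (B : Finset ℕ) :
    Set.InjOn (· / r) (B.filter fun q => q % r = k : Finset ℕ) := by
  intro p hp q hq h
  simp only [Finset.coe_filter, Set.mem_ofPred_eq] at hp hq h
  rw [← Nat.div_add_mod p r, ← Nat.div_add_mod q r, hp.2, hq.2, h]

theorem card_levels (r : ℕ) (B : Finset ℕ) (k : ℕ) :
    (levels r B k).card = (B.filter fun q => q % r = k).card :=
  Finset.card_image_of_injOn (injOn_div_filter_mod r k B)

theorem sum_card_levels {r : ℕ} (hr : 0 < r) (B : Finset ℕ) :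
    ∑ k ∈ Finset.range r, (levels r B k).card = B.card := by
  simp only [card_levels]
  exact (Finset.card_eq_sum_card_fiberwise fun q _ =>
    Finset.mem_coe.mpr (Finset.mem_range.mpr (Nat.mod_lt q hr))).symm

theorem div_mem_levels {r : ℕ} {B : Finset ℕ} {p : ℕ} (hp : p ∈ B) : p / r ∈ levels r B (p % r) :=
  Finset.mem_image_of_mem _ (Finset.mem_filter.mpr ⟨hp, rfl⟩)

theorem card_filter_levels_lt (r : ℕ) (B : Finset ℕ) (p : ℕ) :
    ((levels r B (p % r)).filter fun s => s < p / r).card =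
      (B.filter fun q => q % r = p % r ∧ q < p).card := by
  rw [levels, Finset.filter_image, Finset.card_image_of_injOn
    ((injOn_div_filter_mod r (p % r) B).mono (Finset.coe_subset.mpr (Finset.filter_subset _ _))),
    Finset.filter_filter]
  congr 1
  refine Finset.filter_congr fun q _ => and_congr_right fun h => ?_
  have h1 := Nat.div_add_mod p r
  have h2 := Nat.div_add_mod q r
  refine ⟨fun hlt => ?_, fun hlt => ?_⟩
  · rw [← h1, ← h2, h]
    have : 0 < r := Nat.pos_of_ne_zero fun h0 => by simp [h0] at hlt
    exact Nat.add_lt_add_right (Nat.mul_lt_mul_of_pos_left hlt this) _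
  · by_contra hle
    have := Nat.mul_le_mul_left r (not_lt.mp hle)
    omega

theorem plethAdj_hz_sub {r : ℕ} (hr : 0 < r) (a c : ℕ) :
    plethAdj r (hz ((a : ℤ) - (c : ℤ))) =
      if a % r = c % r then hz (((a / r : ℕ) : ℤ) - ((c / r : ℕ) : ℤ)) else 0 := by
  have ha := Nat.div_add_mod a r
  have hc := Nat.div_add_mod c r
  rw [hz_natCast_sub, hz_natCast_sub]
  by_cases h : a % r = c % r
  · rw [if_pos h]
    by_cases hle : c / r ≤ a / r
    · have h1 : a - c = r * (a / r - c / r) := by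
        rw [Nat.mul_sub]
        omega
      have h2 := Nat.mul_le_mul_left r hle
      rw [if_pos (by omega), if_pos hle, h1, plethAdj_hSym hr, if_pos (dvd_mul_right _ _),
        Nat.mul_div_cancel_left _ hr]
    · have h2 := Nat.mul_lt_mul_of_pos_left (not_le.mp hle) hr
      rw [if_neg (by omega), if_neg hle, map_zero]
  · rw [if_neg h]
    split_ifs with hle
    · rw [plethAdj_hSym hr, if_neg]
      intro hd
      exact h ((Nat.modEq_iff_dvd' hle).mpr hd).symm
    · exact map_zero _

theorem plethAdj_jacobiTrudi {r N : ℕ} (hr : 0 < r) (b : Fin N → ℕ) :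
    plethAdj r (jacobiTrudi b) = Matrix.det (Matrix.of fun i j : Fin N =>
      if b i % r = j % r then hz (((b i / r : ℕ) : ℤ) - ((j / r : ℕ) : ℤ)) else 0) := by
  rw [jacobiTrudi, AlgHom.map_det]
  congr 1
  ext1 i j
  exact plethAdj_hz_sub hr (b i) j

theorem card_filter_fin_mod {r L k : ℕ} (hk : k < r) :
    (Finset.univ.filter fun i : Fin (L * r) => (i : ℕ) % r = k).card = L := by
  conv_rhs => rw [← Fintype.card_fin L, ← Finset.card_univ]
  symm
  refine Finset.card_bij (fun s _ => finProdFinEquiv (s, (⟨k, hk⟩ : Fin r))) ?_ ?_ ?_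
  · intro s _
    simp [Nat.mod_eq_of_lt hk]
  · intro s _ t _ h
    simpa using h
  · intro i hi
    refine ⟨(finProdFinEquiv.symm i).1, Finset.mem_univ _, ?_⟩
    rw [← Equiv.eq_symm_apply]
    exact Prod.ext rfl (Fin.ext (Finset.mem_filter.mp hi).2.symm)

theorem card_filter_orderEmbOfFin {B : Finset ℕ} {N : ℕ} (hB : B.card = N) (P : ℕ → Prop)
    [DecidablePred P] :
    (Finset.univ.filter fun i => P (B.orderEmbOfFin hB i)).card = (B.filter P).card := by
  conv_rhs => rw [← Finset.map_orderEmbOfFin_univ B hB, Finset.filter_map, Finset.card_map]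
  rfl

theorem plethAdj_jacobiTrudi_eq_zero {r L k : ℕ} (hk : k < r) {B : Finset ℕ}
    (hB : B.card = L * r) (h : (levels r B k).card ≠ L) :
    plethAdj r (jacobiTrudi (B.orderEmbOfFin hB)) = 0 := by
  rw [plethAdj_jacobiTrudi (by omega), Matrix.det_apply]
  refine Finset.sum_eq_zero fun τ _ => ?_
  by_cases hτ : ∀ i, B.orderEmbOfFin hB (τ i) % r = i % r
  · refine absurd ?_ h
    rw [card_levels, ← card_filter_orderEmbOfFin hB]
    refine Eq.trans ?_ (card_filter_fin_mod (L := L) hk)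
    refine (Finset.card_bij (fun i _ => τ i) ?_ (fun _ _ _ _ h => τ.injective h) ?_).symm
    · intro i hi
      simpa [hτ] using hi
    · intro i hi
      refine ⟨τ.symm i, ?_, τ.apply_symm_apply i⟩
      have := hτ (τ.symm i)
      rw [τ.apply_symm_apply] at this
      simpa [← this] using hi
  · push Not at hτ
    obtain ⟨i, hi⟩ := hτ
    rw [Finset.prod_eq_zero (Finset.mem_univ i) (by rw [Matrix.of_apply, if_neg hi]), smul_zero]

theorem plethAdj_jacobiTrudi_of_card_levels {r L : ℕ} (hr : 0 < r) {B : Finset ℕ}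
    (hB : B.card = L * r) (h : ∀ k < r, (levels r B k).card = L) :
    plethAdj r (jacobiTrudi (B.orderEmbOfFin hB)) =
      (-1) ^ inversions (rKey r B) B *
        ∏ k ∈ Finset.range r, schur (ptnOfBeads (levels r B k)) := by
  set b := B.orderEmbOfFin hB with hb
  have hbB : ∀ i, b i ∈ B := B.orderEmbOfFin_mem hB
  have hrank : ∀ i, (B.filter fun q => q % r = b i % r ∧ q < b i).card < L := fun i => by
    rw [← card_filter_levels_lt]
    refine lt_of_lt_of_eq ?_ (h (b i % r) (Nat.mod_lt _ hr))
    refine Finset.card_lt_card (Finset.filter_ssubset.mpr ⟨b i / r, div_mem_levels (hbB i), ?_⟩)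
    exact lt_irrefl _
  have hmod : ∀ i, rKey r B (b i) % r = b i % r := fun i => by
    rw [rKey, Nat.mul_add_mod, Nat.mod_mod]
  have hdiv : ∀ i, rKey r B (b i) / r = (B.filter fun q => q % r = b i % r ∧ q < b i).card :=
    fun i => by
      rw [rKey, Nat.mul_add_div hr, Nat.div_eq_of_lt (Nat.mod_lt _ hr), add_zero]
  have hlt : ∀ i, rKey r B (b i) < L * r := fun i => by
    rw [← Nat.div_lt_iff_lt_mul hr, hdiv]
    exact hrank i
  let c (k : Fin r) : Fin L → ℕ := (levels r B k).orderEmbOfFin (h k k.isLt)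
  have hc : ∀ (i) (x : Fin L × Fin r), finProdFinEquiv x = ⟨rKey r B (b i), hlt i⟩ →
      b i % r = x.2 ∧ b i / r = c x.2 x.1 := by
    rintro i x hx
    obtain rfl : x = finProdFinEquiv.symm ⟨rKey r B (b i), hlt i⟩ := by
      rw [← hx, Equiv.symm_apply_apply]
    have h2 : (finProdFinEquiv.symm (⟨rKey r B (b i), hlt i⟩ : Fin (L * r))).2 =
        ⟨b i % r, Nat.mod_lt _ hr⟩ := Fin.ext (hmod i)
    have h1 : (finProdFinEquiv.symm (⟨rKey r B (b i), hlt i⟩ : Fin (L * r))).1 =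
        ⟨((levels r B (b i % r)).filter fun s => s < b i / r).card,
          (card_filter_levels_lt r B (b i)).trans_lt (hrank i)⟩ :=
      Fin.ext ((hdiv i).trans (card_filter_levels_lt r B (b i)).symm)
    rw [h1, h2]
    exact ⟨rfl, (orderEmbOfFin_card_filter_lt _ (div_mem_levels (hbB i)) _).symm⟩
  have hinj : Function.Injective fun i => (⟨rKey r B (b i), hlt i⟩ : Fin (L * r)) := by
    intro i j hij
    have hi := hc i _ (finProdFinEquiv.apply_symm_apply _)
    have hj := hc j _ ((finProdFinEquiv.apply_symm_apply _).trans hij)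
    apply b.injective
    rw [← Nat.div_add_mod (b i) r, ← Nat.div_add_mod (b j) r, hi.1, hi.2, hj.1, hj.2]
  let σ : Equiv.Perm (Fin (L * r)) :=
    Equiv.ofBijective _ (Finite.injective_iff_bijective.mp hinj)
  let D : Matrix (Fin L × Fin r) (Fin L × Fin r) SymF :=
    Matrix.blockDiagonal fun k => Matrix.of fun s t : Fin L => hz ((c k s : ℤ) - (t : ℤ))
  have hA : (Matrix.of fun i j : Fin (L * r) =>
      if b i % r = j % r then hz (((b i / r : ℕ) : ℤ) - ((j / r : ℕ) : ℤ)) else 0) =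
      (D.submatrix finProdFinEquiv.symm finProdFinEquiv.symm).submatrix σ id := by
    ext1 i j
    have hi := hc i _ (finProdFinEquiv.apply_symm_apply _)
    simp only [Matrix.of_apply, Matrix.submatrix_apply, D, Matrix.blockDiagonal_apply, id]
    refine if_congr ?_ ?_ rfl
    · rw [hi.1, Fin.ext_iff]
      rfl
    · rw [hi.2]
      rfl
  rw [plethAdj_jacobiTrudi hr, hA, Matrix.det_permute, Matrix.det_submatrix_equiv_self,
    Matrix.det_blockDiagonal, sign_eq_neg_one_pow_inversions hB (rKey r B) σ fun i => rfl,
    Finset.prod_range]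
  congr 1
  · simp
  · exact Finset.prod_congr rfl fun k _ => (schur_ptnOfBeads (h k k.isLt)).symm

theorem ptnOfBeads_eq_empty_iff (C : Finset ℕ) :
    ptnOfBeads C = Ptn.empty ↔ ∀ p ∈ C, ∀ q < p, q ∈ C := by
  have h1 : ptnOfBeads C = Ptn.empty ↔ ∀ p ∈ C, p ≤ (C.filter fun q => q < p).card := by
    rw [ptnOfBeads, Ptn.of, Ptn.empty, Ptn.mk.injEq, Multiset.filter_eq_nil]
    simp only [Multiset.mem_map, Finset.mem_val, forall_exists_index, and_imp,
      forall_apply_eq_imp_iff₂, not_lt, Nat.le_zero, Nat.sub_eq_zero_iff_le]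
  rw [h1]
  refine forall₂_congr fun p _ => ?_
  have hsub : C.filter (fun q => q < p) ⊆ Finset.range p := fun q hq =>
    Finset.mem_range.mpr (Finset.mem_filter.mp hq).2
  refine ⟨fun h q hq => ?_, fun h => ?_⟩
  · have := Finset.eq_of_subset_of_card_le hsub ((Finset.card_range p).le.trans h)
    exact (Finset.mem_filter.mp (this ▸ Finset.mem_range.mpr hq)).1
  · refine (Finset.card_range p).ge.trans (Finset.card_le_card fun q hq => ?_)
    have hq' := Finset.mem_range.mp hq
    exact Finset.mem_filter.mpr ⟨h q hq', hq'⟩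

theorem ptnOfBeads_biUnion_eq_empty_iff {r L : ℕ} (hr : 0 < r) (m : ℕ → ℕ)
    (hm : ∑ k ∈ Finset.range r, m k = L * r) :
    ptnOfBeads ((Finset.range r).biUnion
      (fun k => (Finset.range (m k)).image (fun s => r * s + k))) = Ptn.empty ↔
      ∀ k < r, m k = L := by
  have hmem : ∀ p, p ∈ (Finset.range r).biUnion
      (fun k => (Finset.range (m k)).image (fun s => r * s + k)) ↔ p / r < m (p % r) := by
    intro p
    simp only [Finset.mem_biUnion, Finset.mem_range, Finset.mem_image]
    refine ⟨?_, fun h => ⟨p % r, Nat.mod_lt _ hr, p / r, h, Nat.div_add_mod p r⟩⟩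
    rintro ⟨k, hk, s, hs, rfl⟩
    rwa [Nat.mul_add_div hr, Nat.mul_add_mod, Nat.div_eq_of_lt hk, Nat.mod_eq_of_lt hk, add_zero]
  rw [ptnOfBeads_eq_empty_iff]
  simp only [hmem]
  refine ⟨fun h => ?_, fun h p hp q hq => ?_⟩
  · have hsum : ∑ k ∈ Finset.range r, m k = ∑ _k ∈ Finset.range r, L := by
      rw [hm, Finset.sum_const, Finset.card_range, smul_eq_mul, mul_comm]
    by_contra! hne
    obtain ⟨k₀, hk₀, hne⟩ := hne
    obtain ⟨k, hk, hlt⟩ : ∃ k < r, L < m k := by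
      by_contra! hle
      exact (Finset.sum_lt_sum (fun k hk => hle k (Finset.mem_range.mp hk))
        ⟨k₀, Finset.mem_range.mpr hk₀, lt_of_le_of_ne (hle k₀ hk₀) hne⟩).ne hsum
    obtain ⟨k', hk', hlt'⟩ : ∃ k < r, m k < L := by
      by_contra! hle
      exact (Finset.sum_lt_sum (fun k hk => hle k (Finset.mem_range.mp hk))
        ⟨k₀, Finset.mem_range.mpr hk₀, lt_of_le_of_ne (hle k₀ hk₀) hne.symm⟩).ne' hsum
    have := h (r * L + k) (by
      rwa [Nat.mul_add_div hr, Nat.mul_add_mod, Nat.div_eq_of_lt hk, Nat.mod_eq_of_lt hk,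
        add_zero]) (r * (L - 1) + k') (by
      obtain ⟨L, rfl⟩ := Nat.exists_eq_succ_of_ne_zero (by omega : L ≠ 0)
      rw [Nat.succ_sub_one, Nat.mul_succ]
      omega)
    rw [Nat.mul_add_div hr, Nat.mul_add_mod, Nat.div_eq_of_lt hk', Nat.mod_eq_of_lt hk',
      add_zero] at this
    omega
  · rw [h _ (Nat.mod_lt _ hr)] at hp ⊢
    exact (Nat.div_le_div_right hq.le).trans_lt hp

theorem betaSet_eq_image_beads (l : Ptn) (N : ℕ) :
    betaSet l N = Finset.univ.image (beads l N) := by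
  ext p
  simp only [betaSet, Finset.mem_image, Finset.mem_range, Finset.mem_univ, true_and, beads]
  constructor
  · rintro ⟨i, hi, rfl⟩
    exact ⟨⟨N - 1 - i, by omega⟩, by simp only [show N - 1 - (N - 1 - i) = i by omega]⟩
  · rintro ⟨i, rfl⟩
    exact ⟨N - 1 - i, by omega, by simp only [show N - 1 - (N - 1 - (i : ℕ)) = i by omega]⟩

theorem card_betaSet (l : Ptn) (N : ℕ) : (betaSet l N).card = N := by
  rw [betaSet_eq_image_beads, Finset.card_image_of_injective _ (beads_strictMono l N).injective,
    Finset.card_univ, Fintype.card_fin]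

theorem orderEmbOfFin_betaSet (l : Ptn) (N : ℕ) :
    ⇑((betaSet l N).orderEmbOfFin (card_betaSet l N)) = beads l N :=
  (Finset.orderEmbOfFin_unique _ (fun i => by
    rw [betaSet_eq_image_beads]
    exact Finset.mem_image_of_mem _ (Finset.mem_univ i)) (beads_strictMono l N)).symm

theorem runnerLevels_eq_levels {r k : ℕ} (hk : k < r) (l : Ptn) :
    runnerLevels r l k = levels r (betaSet l (r * l.length)) k := by
  ext s
  simp only [runnerLevels, levels, Finset.mem_filter, Finset.mem_range, Finset.mem_image]
  constructor
  · rintro ⟨_, hs⟩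
    exact ⟨r * s + k, ⟨hs, by rw [Nat.mul_add_mod, Nat.mod_eq_of_lt hk]⟩,
      by rw [Nat.mul_add_div (by omega), Nat.div_eq_of_lt hk, add_zero]⟩
  · rintro ⟨p, ⟨hp, rfl⟩, rfl⟩
    rw [Nat.div_add_mod]
    refine ⟨?_, hp⟩
    obtain ⟨i, hi, rfl⟩ := Finset.mem_image.mp hp
    have h1 := Nat.div_le_self (l.part i + (r * l.length - 1 - i)) r
    have h2 := l.part_antitone (Nat.zero_le i)
    omega

theorem coreP_eq_empty_iff {r : ℕ} (hr : 0 < r) (l : Ptn) :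
    coreP r l = Ptn.empty ↔
      ∀ k < r, (levels r (betaSet l (r * l.length)) k).card = l.length := by
  rw [coreP, ptnOfBeads_biUnion_eq_empty_iff (L := l.length) hr]
  · exact forall₂_congr fun k hk => by rw [runnerLevels_eq_levels hk]
  · rw [Finset.sum_congr rfl fun k hk => by
      rw [runnerLevels_eq_levels (Finset.mem_range.mp hk)], sum_card_levels hr, card_betaSet,
      mul_comm]

theorem schur_eq_jacobiTrudi_betaSet {r : ℕ} (hr : 0 < r) (l : Ptn)
    (h : (betaSet l (r * l.length)).card = l.length * r) :
    schur l = jacobiTrudi ((betaSet l (r * l.length)).orderEmbOfFin h) := by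
  rw [schur_eq_jacobiTrudi l (Nat.le_mul_of_pos_right l.length hr), ← orderEmbOfFin_betaSet]
  congr! 4
  exact mul_comm _ _

theorem plethAdj_schur_of_coreP_ne {r : ℕ} (hr : 0 < r) {l : Ptn} (h : coreP r l ≠ Ptn.empty) :
    plethAdj r (schur l) = 0 := by
  rw [Ne, coreP_eq_empty_iff hr] at h
  push Not at h
  obtain ⟨k, hk, hne⟩ := h
  rw [schur_eq_jacobiTrudi_betaSet hr l ((card_betaSet _ _).trans (mul_comm _ _))]
  exact plethAdj_jacobiTrudi_eq_zero hk _ hne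

theorem plethAdj_schur_of_coreP_eq {r : ℕ} (hr : 0 < r) {l : Ptn} (h : coreP r l = Ptn.empty) :
    plethAdj r (schur l) =
      (rSign r l : ℚ) • ∏ k ∈ Finset.range r, schur (quotP r l k) := by
  rw [schur_eq_jacobiTrudi_betaSet hr l ((card_betaSet _ _).trans (mul_comm _ _)),
    plethAdj_jacobiTrudi_of_card_levels hr _ ((coreP_eq_empty_iff hr l).mp h), smul_eq_C_mul]
  have h1 : C ((rSign r l : ℤ) : ℚ) =
      (-1 : SymF) ^ inversions (rKey r (betaSet l (r * l.length))) (betaSet l (r * l.length)) := by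
    simp [rSign, rSignExp]
  rw [h1]
  refine congrArg _ (Finset.prod_congr rfl fun k hk => ?_)
  rw [quotP, runnerLevels_eq_levels (Finset.mem_range.mp hk)]

theorem hall_schur_pleth {r : ℕ} (hr : 0 < r) {l : Ptn} (h : coreP r l = Ptn.empty) (lam : Ptn) :
    hall (schur l) (pleth r (schur lam)) = (rSign r l : ℚ) * LRmulti lam r (quotP r l) := by
  rw [← hall_plethAdj hr, plethAdj_schur_of_coreP_eq hr h, hall_comm, hall_smul_right, hall_comm,
    LRmulti, smul_eq_mul]

/-- Proposition 6.2 (Chen–Garsia–Remmel): for `r ≥ 2` and any partition `λ`,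
`p_r ∘ S_λ = Σ_μ δ_r(μ) LR^λ_{μ[0],…,μ[r-1]} S_μ`, summed over all partitions `μ`
of `r|λ|` with empty `r`-core. -/
theorem stmt4 (r : ℕ) (hr : 2 ≤ r) (lam : Ptn) :
    pleth r (schur lam)
      = ∑ᶠ μ ∈ {μ : Ptn | μ.size = r * lam.size ∧ coreP r μ = Ptn.empty},
          (((rSign r μ : ℚ)) * LRmulti lam r (quotP r μ)) • schur μ := by
  have hr0 : 0 < r := by omega
  have hterm : ∀ μ ∈ {μ : Ptn | μ.size = r * lam.size ∧ coreP r μ = Ptn.empty},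
      ((rSign r μ : ℚ) * LRmulti lam r (quotP r μ)) • schur μ =
        hall (schur μ) (pleth r (schur lam)) • schur μ := fun μ hμ => by
    rw [hall_schur_pleth hr0 hμ.2]
  have hext : ∑ᶠ μ ∈ {μ : Ptn | μ.size = r * lam.size ∧ coreP r μ = Ptn.empty},
      hall (schur μ) (pleth r (schur lam)) • schur μ =
      ∑ᶠ μ ∈ {μ : Ptn | μ.size = r * lam.size},
        hall (schur μ) (pleth r (schur lam)) • schur μ := by
    refine finsum_mem_inter_support_eq _ _ _ (Set.ext fun μ => ?_)
    refine and_congr_left fun hμ => ⟨fun h => h.1, fun h => ⟨h, ?_⟩⟩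
    by_contra hc
    refine hμ ?_
    simp only
    rw [← hall_plethAdj hr0, plethAdj_schur_of_coreP_ne hr0 hc]
    simp [hall]
  rw [finsum_mem_congr rfl hterm, hext, ← Nat.Partition.range_toPtn,
    finsum_mem_range Nat.Partition.toPtn_injective, finsum_eq_sum_of_fintype]
  exact eq_sum_hall_schur fun d hd =>
    weight_of_coeff_pleth_ne_zero hr0 (fun _ h => weight_of_coeff_schur_ne_zero h) hd
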